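/- arXiv:math/0506125 — 2 statements merged into one kernel-verified Lean document; each statement's English description precedes it below -/
import Mathlib

section
/- Let 0 ≤ a < b ≤ 1, let μ ∈ ℝ and σ > 0, and let X have the Gaussian distribution N(μ, σ²). Then the expected tranche loss admits the closed form E[Tl_{a,b}(X)] = [ ((μ−a)Φ(d_a) + σφ(d_a)) − ((μ−b)Φ(d_b) + σφ(d_b)) ] / (b − a), where d_a = (μ−a)/σ, d_b = (μ−b)/σ, Φ is the standard normal cumulative distribution function and φ(x) = e^{−x²/2}/√(2π) the standard normal density. (This is the analytic evaluation of the inner integral in the paper's formula for the expected tranche loss.) -/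
open MeasureTheory ProbabilityTheory

/-- The standard normal cumulative distribution function `Φ(x) = γ₀₁(Iic x)`. -/
noncomputable def stdNormalCDF (x : ℝ) : ℝ := ((gaussianReal 0 1) (Set.Iic x)).toReal

/-- The standard normal density `φ(x) = e^{−x²/2}/√(2π)`. -/
noncomputable def stdNormalPDF (x : ℝ) : ℝ :=
  Real.exp (-x ^ 2 / 2) / Real.sqrt (2 * Real.pi)

lemma integral_Iic_id_std (d : ℝ) :
    ∫ z in Set.Iic d, z ∂(gaussianReal 0 1) = - stdNormalPDF d := by
  have hder : ∀ x ∈ Set.Iic d, HasDerivAt (fun z => - stdNormalPDF z)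
      (gaussianPDFReal 0 1 x * x) x := by
    intro x _
    unfold stdNormalPDF
    have h1 : HasDerivAt (fun z : ℝ => -z ^ 2 / 2) (-x) x := by
      have := ((hasDerivAt_pow 2 x).neg).div_const 2
      refine HasDerivAt.congr_deriv this ?_
      norm_num
      ring
    refine HasDerivAt.congr_deriv ((h1.exp).div_const (Real.sqrt (2 * Real.pi))).neg ?_
    simp [gaussianPDFReal]
    ring
  have hint : Integrable (fun x => gaussianPDFReal 0 1 x * x) := by
    have h := (integrable_mul_exp_neg_mul_sq (b := 1/2) (by norm_num)).const_mul
      ((Real.sqrt (2 * Real.pi))⁻¹)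
    refine h.congr (Filter.Eventually.of_forall fun x => ?_)
    simp [gaussianPDFReal]
    ring_nf
  have hlim : Filter.Tendsto (fun z => - stdNormalPDF z) Filter.atBot (nhds 0) := by
    unfold stdNormalPDF
    have h2 : Filter.Tendsto (fun z : ℝ => -z ^ 2 / 2) Filter.atBot Filter.atBot := by
      have h3 : Filter.Tendsto (fun z : ℝ => z ^ 2) Filter.atBot Filter.atTop :=
        Filter.Tendsto.congr (fun z => by simp)
          ((Filter.tendsto_pow_atTop (two_ne_zero)).comp Filter.tendsto_abs_atBot_atTop)
      exact (Filter.tendsto_neg_atTop_atBot.comp h3).atBot_div_const (by norm_num)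
    have := ((Real.tendsto_exp_atBot.comp h2).div_const (Real.sqrt (2 * Real.pi))).neg
    simpa using this
  have key := integral_Iic_of_hasDerivAt_of_tendsto' hder hint.integrableOn hlim
  rw [← integral_indicator measurableSet_Iic,
    integral_gaussianReal_eq_integral_smul (by norm_num)]
  rw [sub_zero, ← integral_indicator measurableSet_Iic] at key
  rw [← key]
  congr 1
  ext x
  by_cases hx : x ∈ Set.Iic d <;> simp [hx]

lemma integrable_id_std : Integrable (fun z : ℝ => z) (gaussianReal 0 1) :=
  (memLp_id_gaussianReal 1).integrable (by simp)

lemma integral_call_std (d : ℝ) :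
    ∫ z, max (d - z) 0 ∂(gaussianReal 0 1) = d * stdNormalCDF d + stdNormalPDF d := by
  have h : (fun z : ℝ => max (d - z) 0) = (Set.Iic d).indicator (fun z => d - z) := by
    ext z
    by_cases hz : z ≤ d
    · simp [hz]
    · simp [hz]
      linarith
  rw [h, integral_indicator measurableSet_Iic,
    integral_sub (integrable_const d) integrable_id_std.integrableOn, integral_Iic_id_std]
  simp [stdNormalCDF, Measure.real]
  ring

lemma integral_call (μ σ c : ℝ) (hσ : 0 < σ) :
    ∫ z, max (μ - σ * z - c) 0 ∂(gaussianReal 0 1)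
      = (μ - c) * stdNormalCDF ((μ - c) / σ) + σ * stdNormalPDF ((μ - c) / σ) := by
  have h : (fun z : ℝ => max (μ - σ * z - c) 0)
      = fun z => σ * max ((μ - c) / σ - z) 0 := by
    ext z
    rw [mul_max_of_nonneg _ _ hσ.le, mul_sub, mul_div_cancel₀ _ (ne_of_gt hσ)]
    simp
    ring_nf
  rw [h, integral_const_mul, integral_call_std, mul_add, ← mul_assoc,
    mul_div_cancel₀ _ (ne_of_gt hσ)]

/-- For `0 ≤ a < b ≤ 1`, `μ ∈ ℝ`, `σ > 0` and `X ~ N(μ, σ²)`, the expected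
tranche loss `E[Tl_{a,b}(X)]`, with `Tl_{a,b}(x) = min(b−a, max(x−a,0))/(b−a)`, equals
`(((μ−a)Φ(d_a) + σφ(d_a)) − ((μ−b)Φ(d_b) + σφ(d_b))) / (b−a)` with `d_a = (μ−a)/σ` and
`d_b = (μ−b)/σ`. -/
theorem gaussian_expected_tranche_loss (a b : ℝ) (ha : 0 ≤ a) (hab : a < b) (hb : b ≤ 1)
    (μ σ : ℝ) (hσ : 0 < σ) :
    ∫ x, min (b - a) (max (x - a) 0) / (b - a) ∂(gaussianReal μ (Real.toNNReal (σ ^ 2)))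
      = (((μ - a) * stdNormalCDF ((μ - a) / σ) + σ * stdNormalPDF ((μ - a) / σ))
          - ((μ - b) * stdNormalCDF ((μ - b) / σ) + σ * stdNormalPDF ((μ - b) / σ)))
        / (b - a) := by
  have hmap : gaussianReal μ (Real.toNNReal (σ ^ 2))
      = (gaussianReal 0 1).map (fun z => μ - σ * z) := by
    have h1 := gaussianReal_map_const_mul (μ := 0) (v := 1) σ
    have h2 := gaussianReal_map_const_sub (μ := 0) (v := Real.toNNReal (σ ^ 2)) μ
    have h3 : NNReal.mk (σ ^ 2) (sq_nonneg σ) = Real.toNNReal (σ ^ 2) := by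
      ext
      simp [sq_nonneg]
    rw [mul_zero, mul_one, h3] at h1
    rw [sub_zero, ← h1, Measure.map_map (by fun_prop) (by fun_prop)] at h2
    exact h2.symm
  have hi : ∀ c : ℝ, Integrable (fun z : ℝ => max (μ - σ * z - c) 0) (gaussianReal 0 1) :=
    fun c => (((integrable_const μ).sub (integrable_id_std.const_mul σ)).sub
      (integrable_const c)).pos_part
  rw [integral_div, hmap, integral_map (by fun_prop) (by fun_prop), ← integral_call μ σ a hσ,
    ← integral_call μ σ b hσ, ← integral_sub (hi a) (hi b)]
  congr 2
  ext z
  rcases le_total (μ - σ * z) a with h | h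
  · rw [max_eq_right (by linarith), max_eq_right (by linarith), min_eq_right (by linarith)]
    ring
  · rcases le_total (μ - σ * z) b with h' | h'
    · rw [max_eq_left (by linarith), max_eq_right (by linarith), min_eq_right (by linarith)]
      ring
    · rw [max_eq_left (by linarith), max_eq_left (by linarith), min_eq_left (by linarith)]
      ring
end

section
/- Let H_n denote the probabilists' Hermite polynomial of degree n, defined by the Rodrigues formula H_n(x) = (−1)^n e^{x²/2} (d^n/dx^n) e^{−x²/2}. Then for all natural numbers n, m, the orthogonality relation ∫_ℝ H_n(x) H_m(x) e^{−x²/2}/√(2π) dx = n! if n = m and 0 if n ≠ m holds; equivalently, ∫_ℝ H_n H_m dγ = n!·δ_{nm} where γ is the standard Gaussian measure on ℝ. -/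
open MeasureTheory ProbabilityTheory

/-- The probabilists' Hermite polynomial of degree `n`, via the Rodrigues formula
`H_n(x) = (−1)^n e^{x²/2} (d^n/dx^n) e^{−x²/2}`. -/
noncomputable def hermiteH (n : ℕ) (x : ℝ) : ℝ :=
  (-1) ^ n * Real.exp (x ^ 2 / 2) * iteratedDeriv n (fun t => Real.exp (-t ^ 2 / 2)) x

open Polynomial in
lemma derivative_hermite_succ_aux (n : ℕ) :
    derivative (hermite (n + 1)) = ((n + 1 : ℕ) : ℤ[X]) * hermite n := by
  induction n with
  | zero => simp
  | succ k ih =>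
    rw [hermite_succ (k + 1)]
    simp only [derivative_sub, derivative_mul, derivative_X, ih, derivative_natCast]
    rw [hermite_succ k]
    push_cast
    ring

lemma integrable_poly_gauss_aux (P : Polynomial ℝ) :
    Integrable (fun x : ℝ => P.eval x * Real.exp (-x ^ 2 / 2)) := by
  induction P using Polynomial.induction_on' with
  | add p q hp hq =>
    simp only [Polynomial.eval_add, add_mul]
    exact hp.add hq
  | monomial n a =>
    have h := integrable_rpow_mul_exp_neg_mul_sq (b := 1 / 2) (by norm_num) (s := (n : ℝ))
      (by have : (0 : ℝ) ≤ n := Nat.cast_nonneg n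
          linarith)
    refine (h.const_mul a).congr (Filter.Eventually.of_forall fun x => ?_)
    simp only [Polynomial.eval_monomial, Real.rpow_natCast]
    rw [mul_assoc]
    congr 3
    ring

lemma integral_poly_gauss_aux (P : Polynomial ℝ) :
    ∫ x : ℝ, (Polynomial.derivative P - Polynomial.X * P).eval x * Real.exp (-x ^ 2 / 2) = 0 := by
  refine integral_eq_zero_of_hasDerivAt_of_integrable
    (f := fun x => P.eval x * Real.exp (-x ^ 2 / 2)) (fun x => ?_)
    (integrable_poly_gauss_aux _) (integrable_poly_gauss_aux _)
  have h1 : HasDerivAt (fun x : ℝ => -x ^ 2 / 2) (-x) x := by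
    have := ((hasDerivAt_pow 2 x).neg).div_const 2
    refine this.congr_deriv ?_
    push_cast
    ring
  refine ((P.hasDerivAt x).mul h1.exp).congr_deriv ?_
  simp only [Polynomial.eval_sub, Polynomial.eval_mul, Polynomial.eval_X]
  ring

/-- Real Hermite polynomial. -/
noncomputable def hermR (n : ℕ) : Polynomial ℝ :=
  (Polynomial.hermite n).map (Int.castRingHom ℝ)

lemma hermiteH_eq_aux (n : ℕ) (x : ℝ) : hermiteH n x = (hermR n).eval x := by
  have h := Polynomial.hermite_eq_deriv_gaussian' n x
  rw [hermR, Polynomial.eval_map, ← algebraMap_int_eq, ← Polynomial.aeval_def, h, hermiteH,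
    iteratedDeriv_eq_iterate]
  simp only [neg_div]
  ring

lemma hermR_succ (n : ℕ) :
    hermR (n + 1) = Polynomial.X * hermR n - Polynomial.derivative (hermR n) := by
  simp [hermR, Polynomial.hermite_succ, Polynomial.derivative_map]

lemma hermR_deriv (n : ℕ) :
    Polynomial.derivative (hermR (n + 1)) = Polynomial.C ((n : ℝ) + 1) * hermR n := by
  rw [hermR, Polynomial.derivative_map, derivative_hermite_succ_aux]
  simp [hermR]

lemma hermR_zero : hermR 0 = 1 := by simp [hermR]

/-- Gaussian pairing. -/
noncomputable def gI (P : Polynomial ℝ) : ℝ := ∫ x : ℝ, P.eval x * Real.exp (-x ^ 2 / 2)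

lemma gI_step (n : ℕ) (Q : Polynomial ℝ) :
    gI (hermR (n + 1) * Q) = gI (hermR n * Polynomial.derivative Q) := by
  have h := integral_poly_gauss_aux (hermR n * Q)
  have h2 : gI (hermR n * Polynomial.derivative Q) - gI (hermR (n + 1) * Q) = 0 := by
    rw [← h, gI, gI, ← integral_sub (integrable_poly_gauss_aux _) (integrable_poly_gauss_aux _)]
    congr 1
    ext x
    rw [← sub_mul, ← Polynomial.eval_sub]
    congr 2
    rw [hermR_succ, Polynomial.derivative_mul]
    ring
  linarith

lemma gI_C_mul (c : ℝ) (Q : Polynomial ℝ) : gI (Polynomial.C c * Q) = c * gI Q := by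
  simp [gI, mul_assoc, integral_const_mul]

lemma gI_herm (n m : ℕ) : gI (hermR n * hermR m) =
    if n = m then (Nat.factorial n : ℝ) * Real.sqrt (2 * Real.pi) else 0 := by
  induction n generalizing m with
  | zero =>
    cases m with
    | zero =>
      have h := integral_gaussian (1 / 2)
      simp only [hermR_zero, gI, if_true]
      simp only [mul_one, Polynomial.eval_one, one_mul, Nat.factorial_zero, Nat.cast_one]
      convert h using 2
      · ext x
        congr 1
        ring
      · rw [div_div_eq_mul_div, div_one, mul_comm]
    | succ m =>
      rw [mul_comm, gI_step]
      simp [hermR_zero, gI]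
  | succ n ih =>
    rw [gI_step]
    cases m with
    | zero => simp [hermR_zero, gI]
    | succ m =>
      rw [hermR_deriv, mul_left_comm, gI_C_mul, ih]
      by_cases h : n = m
      · subst h
        simp [Nat.factorial_succ]
        ring
      · simp [h]

/-- Orthogonality of the probabilists' Hermite polynomials with respect to the
standard Gaussian measure: `∫ H_n H_m dγ = n!·δ_{nm}`, equivalently
`∫ H_n(x) H_m(x) e^{−x²/2}/√(2π) dx = n!` if `n = m` and `0` otherwise. -/
theorem hermite_orthogonality (n m : ℕ) :
    (∫ x, hermiteH n x * hermiteH m x ∂(gaussianReal 0 1)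
        = if n = m then ((Nat.factorial n : ℕ) : ℝ) else 0) ∧
      (∫ x, hermiteH n x * hermiteH m x * (Real.exp (-x ^ 2 / 2) / Real.sqrt (2 * Real.pi))
        = if n = m then ((Nat.factorial n : ℕ) : ℝ) else 0) := by
  have key : (∫ x, hermiteH n x * hermiteH m x * (Real.exp (-x ^ 2 / 2) / Real.sqrt (2 * Real.pi))
        = if n = m then ((Nat.factorial n : ℕ) : ℝ) else 0) := by
    have h := gI_herm n m
    have hs : Real.sqrt (2 * Real.pi) ≠ 0 := by positivity
    simp only [hermiteH_eq_aux, ← Polynomial.eval_mul, ← mul_div_assoc]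
    rw [integral_div]
    rw [gI] at h
    rw [h]
    split_ifs
    · field_simp
    · simp
  refine ⟨?_, key⟩
  rw [← key, integral_gaussianReal_eq_integral_smul (by norm_num)]
  congr 1
  ext x
  simp only [gaussianPDFReal, smul_eq_mul, NNReal.coe_one, mul_one, sub_zero]
  ring
end
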